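/- Let (εT,εX) ∈ ℕ² with εT ≥ q and εX ≥ q. Then the minimum distance satisfies d_η(δT,δX) ≥ min over M ∈ Δ*(δT,δX) of #Δ*(εT,εX)_M, where Δ*(εT,εX)_M := {N ∈ Δ*(εT,εX) : M divides N}. -/

import Mathlib

open MvPolynomial

attribute [local instance] Classical.propDecidable

namespace Hirz

/-- Index type for the `(q+1)²` rational points of the Hirzebruch surface. -/
abbrev HIdx (F : Type) := (F × F) ⊕ F ⊕ F ⊕ Unit

variable (F : Type) [Field F] [Fintype F]

/-- The homogeneous coordinates of the rational points of `H_η`. -/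
def pt : HIdx F → Fin 4 → F
  | Sum.inl (a, b) => ![1, a, 1, b]
  | Sum.inr (Sum.inl b) => ![0, 1, 1, b]
  | Sum.inr (Sum.inr (Sum.inl a)) => ![1, a, 0, 1]
  | Sum.inr (Sum.inr (Sum.inr _)) => ![0, 1, 0, 1]

/-- Evaluation of a polynomial at all the rational points. -/
noncomputable def ev (P : MvPolynomial (Fin 4) F) : HIdx F → F :=
  fun i => eval (pt F i) P

/-- `c` is the exponent vector (T1,T2,X1,X2) of a monomial of bidegree `(δT, δX)`. -/
def IsBideg (η : ℕ) (δT : ℤ) (δX : ℕ) (c : Fin 4 → ℕ) : Prop :=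
  (c 0 : ℤ) + (c 1 : ℤ) - (η : ℤ) * (c 2 : ℤ) = δT ∧ c 2 + c 3 = δX

/-- The monomial with exponent vector `c`. -/
noncomputable def mon (c : Fin 4 → ℕ) : MvPolynomial (Fin 4) F :=
  monomial (Finsupp.equivFunOnFinite.symm c) (1 : F)

/-- The set of monomials of bidegree `(δT, δX)`. -/
def MSet (η : ℕ) (δT : ℤ) (δX : ℕ) : Set (MvPolynomial (Fin 4) F) :=
  {P | ∃ c : Fin 4 → ℕ, IsBideg η δT δX c ∧ P = mon F c}

/-- `R(δT,δX)`, the space of homogeneous polynomials of bidegree `(δT,δX)`. -/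
noncomputable def RSpan (η : ℕ) (δT : ℤ) (δX : ℕ) : Submodule F (MvPolynomial (Fin 4) F) :=
  Submodule.span F (MSet F η δT δX)

/-- The code `C_η(δT,δX)`, image of `R(δT,δX)` under evaluation. -/
noncomputable def Code (η : ℕ) (δT : ℤ) (δX : ℕ) : Submodule F (HIdx F → F) :=
  Submodule.span F (ev F '' MSet F η δT δX)

/-- Hamming weight. -/
noncomputable def wt (v : HIdx F → F) : ℕ := {i | v i ≠ 0}.ncard

/-- Minimum distance of `C_η(δT,δX)`. -/
noncomputable def dmin (η : ℕ) (δT : ℤ) (δX : ℕ) : ℕ :=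
  sInf {w : ℕ | ∃ v ∈ Code F η δT δX, v ≠ 0 ∧ wt F v = w}

/-- `⌊A⌋` where `A = δX` if `δT ≥ 0` and `A = δ/η` otherwise. -/
def Afloor (η : ℕ) (δT : ℤ) (δX : ℕ) : ℤ :=
  if 0 ≤ δT then (δX : ℤ) else (δT + (η : ℤ) * (δX : ℤ)) / (η : ℤ)

/-- Exponent vector of the monomial `M(d2,c2)`. -/
def Mexp (η : ℕ) (δT : ℤ) (δX : ℕ) (d2 c2 : ℕ) : Fin 4 → ℕ :=
  ![(δT + (η : ℤ) * ((δX : ℤ) - (d2 : ℤ)) - (c2 : ℤ)).toNat, c2, δX - d2, d2]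

/-- The monomial `M(d2,c2) = T1^(δT+η(δX-d2)-c2) T2^c2 X1^(δX-d2) X2^d2`. -/
noncomputable def Mmon (η : ℕ) (δT : ℤ) (δX : ℕ) (d2 c2 : ℕ) : MvPolynomial (Fin 4) F :=
  mon F (Mexp η δT δX d2 c2)

/-- The lattice polygon `P(δT,δX)`. -/
def PSet (η : ℕ) (δT : ℤ) (δX : ℕ) : Set (ℕ × ℕ) :=
  {p | (p.1 : ℤ) ≤ Afloor η δT δX ∧ (p.2 : ℤ) ≤ δT + (η : ℤ) * ((δX : ℤ) - (p.1 : ℤ))}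

/-- The set `A_X = {α : α ≤ min(⌊A⌋, q-1)} ∪ ({A} ∩ ℕ)`. -/
def AX (η : ℕ) (δT : ℤ) (δX : ℕ) (q : ℕ) : Set ℕ :=
  {α | (α : ℤ) ≤ min (Afloor η δT δX) ((q : ℤ) - 1)} ∪
    {α | if 0 ≤ δT then (α : ℤ) = (δX : ℤ)
         else (α : ℤ) * (η : ℤ) = δT + (η : ℤ) * (δX : ℤ)}

/-- The set of representatives `K(δT,δX)`. -/
def KSet (η : ℕ) (δT : ℤ) (δX : ℕ) (q : ℕ) : Set (ℕ × ℕ) :=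
  {p | p.1 ∈ AX η δT δX q ∧
    ((p.2 : ℤ) ≤ min (δT + (η : ℤ) * (δX : ℤ) - (η : ℤ) * (p.1 : ℤ)) (q : ℤ) - 1 ∨
      (p.2 : ℤ) = δT + (η : ℤ) * (δX : ℤ) - (η : ℤ) * (p.1 : ℤ))}

/-- Condition (H): `η ≥ 2`, `δT < 0`, `η ∣ δT` and `q ≤ δX + δT/η`. -/
def CondH (η : ℕ) (δT : ℤ) (δX : ℕ) (q : ℕ) : Prop :=
  2 ≤ η ∧ δT < 0 ∧ (η : ℤ) ∣ δT ∧ (q : ℤ) ≤ (δX : ℤ) + δT / (η : ℤ)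

/-- `K*(δT,δX)`: `K(δT,δX)` minus `(δ/η, 0)` if (H) holds. -/
def KStar (η : ℕ) (δT : ℤ) (δX : ℕ) (q : ℕ) : Set (ℕ × ℕ) :=
  if CondH η δT δX q then
    KSet η δT δX q \ {(((δT + (η : ℤ) * (δX : ℤ)) / (η : ℤ)).toNat, 0)}
  else KSet η δT δX q

/-- `Δ*(δT,δX) = {M(α,β) : (α,β) ∈ K*(δT,δX)}`. -/
noncomputable def DeltaStar (η : ℕ) (δT : ℤ) (δX : ℕ) (q : ℕ) :
    Set (MvPolynomial (Fin 4) F) :=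
  {P | ∃ p ∈ KStar η δT δX q, P = Mmon F η δT δX p.1 p.2}

set_option linter.unusedSectionVars false

theorem ev_mon_inl (c : Fin 4 → ℕ) (a b : F) :
    ev F (mon F c) (Sum.inl (a, b)) = a ^ c 1 * b ^ c 3 := by
  simp [ev, mon, pt, eval_monomial, Finsupp.prod_fintype, Fin.prod_univ_four]

theorem ev_mon_inr_inl (c : Fin 4 → ℕ) (b : F) :
    ev F (mon F c) (Sum.inr (Sum.inl b)) = 0 ^ c 0 * b ^ c 3 := by
  simp [ev, mon, pt, eval_monomial, Finsupp.prod_fintype, Fin.prod_univ_four]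

theorem ev_mon_inr_inr_inl (c : Fin 4 → ℕ) (a : F) :
    ev F (mon F c) (Sum.inr (Sum.inr (Sum.inl a))) = a ^ c 1 * 0 ^ c 2 := by
  simp [ev, mon, pt, eval_monomial, Finsupp.prod_fintype, Fin.prod_univ_four]

theorem ev_mon_inr_inr_inr (c : Fin 4 → ℕ) (u : Unit) :
    ev F (mon F c) (Sum.inr (Sum.inr (Sum.inr u))) = 0 ^ c 0 * 0 ^ c 2 := by
  simp [ev, mon, pt, eval_monomial, Finsupp.prod_fintype, Fin.prod_univ_four]

theorem mon_add (c d : Fin 4 → ℕ) : mon F (c + d) = mon F c * mon F d := by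
  simp only [mon, monomial_mul, one_mul]
  congr 2
  ext i
  simp

theorem ev_mon_add (c d : Fin 4 → ℕ) :
    ev F (mon F (c + d)) = ev F (mon F c) * ev F (mon F d) := by
  funext i
  simp [ev, mon_add]

theorem le_of_mon_dvd_mon {c d : Fin 4 → ℕ} (h : mon F c ∣ mon F d) : c ≤ d := by
  have h' := (monomial_dvd_monomial.1 h).1
  exact h'.resolve_left one_ne_zero

/-- Over a field with `r + 1` elements, adding a multiple of `r` to a positive exponent
does not change the power map. -/
theorem pow_add_mul_eq {r : ℕ} (hr : Fintype.card F = r + 1) (x : F) {n : ℕ} (hn : 0 < n)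
    (k : ℕ) : x ^ (n + k * r) = x ^ n := by
  by_cases hx : x = 0
  · subst hx
    rw [zero_pow hn.ne', zero_pow (by omega)]
  · have h := FiniteField.pow_card_sub_one_eq_one x hx
    rw [hr, Nat.add_sub_cancel] at h
    rw [pow_add, mul_comm k r, pow_mul, h, one_pow, mul_one]

/-- A weight on exponent vectors, which orders the monomials of a given bidegree
lexicographically in `(X2, T2)` when `W` is large. -/
def expKey (W : ℕ) (c : Fin 4 → ℕ) : ℕ := c 1 + W * c 3

/-- The span of the evaluations of the monomials of given bidegree and weight less than `n`. -/
noncomputable def lowSpan (W η : ℕ) (δT : ℤ) (δX n : ℕ) : Submodule F (HIdx F → F) :=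
  Submodule.span F {u | ∃ c, IsBideg η δT δX c ∧ expKey W c < n ∧ u = ev F (mon F c)}

variable {F}

theorem mem_lowSpan {W η : ℕ} {δT : ℤ} {δX n : ℕ} {c : Fin 4 → ℕ}
    (hc : IsBideg η δT δX c) (hn : expKey W c < n) :
    ev F (mon F c) ∈ lowSpan F W η δT δX n :=
  Submodule.subset_span ⟨c, hc, hn, rfl⟩

theorem mon_mem_DeltaStar {η : ℕ} {δT : ℤ} {δX q : ℕ} {c : Fin 4 → ℕ}
    (hc : IsBideg η δT δX c) (hK : (c 3, c 1) ∈ KStar η δT δX q) :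
    mon F c ∈ DeltaStar F η δT δX q := by
  refine ⟨_, hK, ?_⟩
  obtain ⟨h1, h2⟩ := hc
  unfold Mmon
  congr 1
  funext i
  have h2' : (δX : ℤ) = c 2 + c 3 := by exact_mod_cast h2.symm
  fin_cases i
  · simp only [Mexp, Fin.zero_eta, Matrix.cons_val_zero]
    have : δT + (η : ℤ) * ((δX : ℤ) - (c 3 : ℤ)) - (c 1 : ℤ) = c 0 := by
      rw [h2', ← h1]; ring
    rw [this, Int.toNat_natCast]
  · rfl
  · simp [Mexp]; omega
  · rfl

/-- Sufficient condition for an exponent vector to be a reduced representative. -/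
theorem mem_KStar {η : ℕ} {δT : ℤ} {δX q : ℕ} {c : Fin 4 → ℕ}
    (hη : δT < 0 → 0 < η) (hc : IsBideg η δT δX c)
    (h3 : c 3 < q ∨ c 2 = 0 ∨ (η = 1 ∧ c 0 = 0 ∧ c 1 = 0)) (h1 : c 1 < q ∨ c 0 = 0) :
    (c 3, c 1) ∈ KStar η δT δX q := by
  obtain ⟨hb, h2⟩ := hc
  have h2' : (δX : ℤ) = c 2 + c 3 := by exact_mod_cast h2.symm
  have hδ : δT + (η : ℤ) * δX - η * c 3 = c 0 + c 1 := by rw [h2', ← hb]; ring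
  have hK : (c 3, c 1) ∈ KSet η δT δX q := by
    refine ⟨?_, ?_⟩
    · rcases h3 with h3 | h3 | ⟨h3, h4, h5⟩
      · left
        have hq : (c 3 : ℤ) ≤ q - 1 := by omega
        refine le_min ?_ hq
        unfold Afloor
        split_ifs with h
        · omega
        · rw [Int.le_ediv_iff_mul_le (by have := hη (by omega); omega), mul_comm]
          omega
      · right
        have : 0 ≤ δT := by rw [← hb, h3]; push_cast; omega
        simp only [Set.mem_ofPred_eq, if_pos this]; omega
      · right
        subst h3
        simp only [Set.mem_ofPred_eq]
        split_ifs <;> push_cast at * <;> omega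
    · simp only [hδ]
      by_cases h0 : c 0 = 0
      · right; omega
      · left; omega
  unfold KStar
  split_ifs with hH
  · refine ⟨hK, ?_⟩
    obtain ⟨H1, H2, ⟨k, rfl⟩, H4⟩ := hH
    have hη0 : (η : ℤ) ≠ 0 := by omega
    rw [Int.mul_ediv_cancel_left _ hη0] at H4
    rw [← mul_add, Int.mul_ediv_cancel_left _ hη0]
    simp only [Set.mem_singleton_iff, Prod.mk.injEq, not_and]
    intro e1 e2
    have e3 : (c 3 : ℤ) = k + δX := by omega
    rcases h3 with h3 | h3 | h3
    · omega
    · have : k < 0 := by nlinarith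
      omega
    · omega
  · exact hK

/-- Every monomial is reduced, or its evaluation is a combination of smaller ones. -/
theorem reduction {η : ℕ} {δT : ℤ} {δX W : ℕ} {c : Fin 4 → ℕ} (hW : η < W)
    (hη : δT < 0 → 0 < η) (hc : IsBideg η δT δX c) :
    mon F c ∈ DeltaStar F η δT δX (Fintype.card F) ∨
      ev F (mon F c) ∈ lowSpan F W η δT δX (expKey W c) := by
  obtain ⟨r, hr⟩ : ∃ r, Fintype.card F = r + 1 :=
    ⟨Fintype.card F - 1, by have := Fintype.one_lt_card (α := F); omega⟩
  have hr0 : 0 < r := by have := Fintype.one_lt_card (α := F); omega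
  have hpow := fun (x : F) (n : ℕ) (hn : 0 < n) k => pow_add_mul_eq F hr x (n := n) hn k
  have hpow1 : ∀ (x : F) m, x ^ (m + 1 + r) = x ^ (m + 1) := fun x m => by
    simpa using hpow x (m + 1) m.succ_pos 1
  have hdrop : ∀ n, n ≤ η * r → n < W * r := fun n hn =>
    hn.trans_lt (Nat.mul_lt_mul_of_pos_right hW hr0)
  obtain ⟨hb, h2⟩ := id hc
  by_cases hA : c 3 < Fintype.card F ∨ c 2 = 0 ∨ (η = 1 ∧ c 0 = 0 ∧ c 1 = 0)
  · by_cases hB : c 1 < Fintype.card F ∨ c 0 = 0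
    · exact Or.inl (mon_mem_DeltaStar hc (mem_KStar hη hc hA hB))
    right
    obtain ⟨hB1, hB0⟩ := not_or.1 hB
    obtain ⟨m, hm⟩ : ∃ m, c 1 = (m + 1) + r := ⟨c 1 - r - 1, by omega⟩
    have key : ev F (mon F c) = ev F (mon F ![c 0 + r, m + 1, c 2, c 3]) := by
      funext i
      rcases i with ⟨a, b⟩ | b | a | u
      · simp [ev_mon_inl, hm, hpow1]
      · simp [ev_mon_inr_inl, hB0]
      · simp [ev_mon_inr_inr_inl, hm, hpow1]
      · simp [ev_mon_inr_inr_inr, hB0]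
    rw [key]
    refine mem_lowSpan ⟨?_, ?_⟩ ?_
    · simp; omega
    · simpa using h2
    · simp [expKey]; omega
  · right
    simp only [not_or, not_lt] at hA
    obtain ⟨hA3, hA2, hA1⟩ := hA
    obtain ⟨m, hm⟩ : ∃ m, c 3 = (m + 1) + r := ⟨c 3 - r - 1, by omega⟩
    have hWm : W * c 3 = W * (m + 1) + W * r := by rw [hm]; ring
    by_cases h0 : c 0 = 0
    · by_cases h1 : 0 < c 1 ∨ η = 0
      · have key : ev F (mon F c) = ev F (mon F ![0, c 1 + η * r, c 2 + r, m + 1]) := by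
          have h1' : ∀ a : F, a ^ (c 1 + η * r) = a ^ c 1 := by
            rcases h1 with h1 | h1
            · exact fun a => hpow a _ h1 η
            · simp [h1]
          funext i
          rcases i with ⟨a, b⟩ | b | a | u
          · simp [ev_mon_inl, hm, hpow1, h1']
          · simp [ev_mon_inr_inl, hm, hpow1, h0]
          · simp [ev_mon_inr_inr_inl, hA2]
          · simp [ev_mon_inr_inr_inr, hA2]
        rw [key]
        have := hdrop _ le_rfl
        refine mem_lowSpan ⟨?_, ?_⟩ ?_
        · simp; rw [← hb, h0]; push_cast; ring
        · simp; omega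
        · simp [expKey]; omega
      · obtain ⟨h1, h1'⟩ := not_or.1 h1
        have h10 : c 1 = 0 := by omega
        have hη2 : 2 ≤ η := by
          have : η ≠ 1 := fun h => hA1 ⟨h, h0, h10⟩
          omega
        obtain ⟨s, rfl⟩ : ∃ s, η = s + 2 := ⟨η - 2, by omega⟩
        have hr1 : ∀ a : F, a ^ ((s + 2) * r) = a ^ r := by
          intro a
          rw [show (s + 2) * r = r + (s + 1) * r by ring]
          exact hpow a r hr0 _
        have key : ev F (mon F c) = ev F (mon F ![(s + 2) * r, 0, c 2 + r, m + 1])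
            + ev F (mon F ![0, (s + 2) * r, c 2 + r, m + 1])
            - ev F (mon F ![(s + 1) * r, r, c 2 + r, m + 1]) := by
          funext i
          rcases i with ⟨a, b⟩ | b | a | u
          · simp [ev_mon_inl, hm, hpow1, hr1, h10]
          · simp [ev_mon_inr_inl, hm, hpow1, h0, hr0.ne']
          · simp [ev_mon_inr_inr_inl, hA2, hr0.ne']
          · simp [ev_mon_inr_inr_inr, hA2, hr0.ne']
        rw [key]
        have d1 := hdrop _ le_rfl
        have d2 := hdrop r (by nlinarith)
        rw [h0, h10] at hb
        refine sub_mem (add_mem ?_ ?_) ?_ <;> refine mem_lowSpan ⟨?_, ?_⟩ ?_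
        · simp; rw [← hb]; push_cast; ring
        · simp; omega
        · simp [expKey]; omega
        · simp; rw [← hb]; push_cast; ring
        · simp; omega
        · simp [expKey]; omega
        · simp; rw [← hb]; push_cast; ring
        · simp; omega
        · simp [expKey]; omega
    · have key : ev F (mon F c) = ev F (mon F ![c 0 + η * r, c 1, c 2 + r, m + 1]) := by
        funext i
        rcases i with ⟨a, b⟩ | b | a | u
        · simp [ev_mon_inl, hm, hpow1]
        · simp [ev_mon_inr_inl, h0]
        · simp [ev_mon_inr_inr_inl, hA2]
        · simp [ev_mon_inr_inr_inr, hA2]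
      rw [key]
      have := hdrop 0 (Nat.zero_le _)
      refine mem_lowSpan ⟨?_, ?_⟩ ?_
      · simp; rw [← hb]; ring
      · simp; omega
      · simp [expKey]; omega

theorem expKey_add (W : ℕ) (c d : Fin 4 → ℕ) :
    expKey W (c + d) = expKey W c + expKey W d := by
  simp [expKey]; ring

theorem ev_mon_mul_mem_lowSpan {W η : ℕ} {δT εT : ℤ} {δX εX n : ℕ} {c d : Fin 4 → ℕ}
    (hc : IsBideg η δT δX c) (hcd : IsBideg η εT εX (c + d)) {u : HIdx F → F}
    (hu : u ∈ lowSpan F W η δT δX n) :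
    ev F (mon F d) * u ∈ lowSpan F W η εT εX (n + expKey W d) := by
  have : lowSpan F W η δT δX n ≤
      (lowSpan F W η εT εX (n + expKey W d)).comap (LinearMap.mulLeft F (ev F (mon F d))) := by
    refine Submodule.span_le.2 ?_
    rintro _ ⟨c', hc', hn, rfl⟩
    simp only [SetLike.mem_coe, Submodule.mem_comap, LinearMap.mulLeft_apply]
    rw [mul_comm, ← ev_mon_add]
    refine mem_lowSpan ⟨?_, ?_⟩ ?_
    · have h1 := hc.1
      have h2 := hcd.1
      have h3 := hc'.1
      simp only [Pi.add_apply] at *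
      push_cast at *
      linarith
    · have h1 := hc.2
      have h2 := hcd.2
      have h3 := hc'.2
      simp only [Pi.add_apply] at *
      omega
    · rw [expKey_add]; omega
  exact this hu

/-- A nonzero codeword has a reduced leading monomial. -/
theorem exists_leading {η : ℕ} {δT : ℤ} {δX : ℕ} (hη : δT < 0 → 0 < η) {v : HIdx F → F}
    (hv : v ∈ Code F η δT δX) (hv0 : v ≠ 0) :
    ∃ W, η < W ∧ ∃ c k, IsBideg η δT δX c ∧ mon F c ∈ DeltaStar F η δT δX (Fintype.card F) ∧
      ev F (mon F c) - (k : F) • v ∈ lowSpan F W η δT δX (expKey W c) := by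
  set W := δT.natAbs + η * δX + η + 1 with hWdef
  have hbd : ∀ c, IsBideg η δT δX c → c 1 < W ∧ c 3 ≤ δX := by
    rintro c ⟨h1, h2⟩
    have : η * c 2 ≤ η * δX := Nat.mul_le_mul_left _ (by omega)
    have h3 : ((η * c 2 : ℕ) : ℤ) = (η : ℤ) * c 2 := by push_cast; rfl
    omega
  have hinj : ∀ c d, IsBideg η δT δX c → IsBideg η δT δX d →
      expKey W c = expKey W d → c = d := by
    intro c d hc hd h
    have bc := (hbd c hc).1
    have bd := (hbd d hd).1
    unfold expKey at h
    have e1 : c 1 = d 1 := by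
      have := congrArg (· % W) h
      simpa [Nat.add_mul_mod_self_left, Nat.mod_eq_of_lt bc, Nat.mod_eq_of_lt bd] using this
    have e3 : c 3 = d 3 := by
      rw [e1] at h
      exact Nat.eq_of_mul_eq_mul_left (by omega) (Nat.add_left_cancel h)
    have e2 : c 2 = d 2 := by have := hc.2; have := hd.2; omega
    have e0 : c 0 = d 0 := by
      have h1 := hc.1
      have h2 := hd.1
      rw [e1, e2] at h1
      omega
    funext i
    fin_cases i <;> assumption
  have hex : ∃ n, v ∈ lowSpan F W η δT δX n := by
    refine ⟨W + W * δX, ?_⟩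
    refine (Submodule.span_le.2 ?_ : Code F η δT δX ≤ _) hv
    rintro _ ⟨_, ⟨c, hc, rfl⟩, rfl⟩
    refine mem_lowSpan hc ?_
    obtain ⟨h1, h3⟩ := hbd c hc
    have := Nat.mul_le_mul_left W h3
    unfold expKey
    omega
  have hmin := fun m => Nat.find_min (m := m) hex
  have hn := Nat.find_spec hex
  generalize Nat.find hex = n at hmin hn
  obtain _ | m := n
  · exfalso
    apply hv0
    simpa [lowSpan] using hn
  have hm := hmin m (Nat.lt_succ_self m)
  by_cases hc : ∃ c, IsBideg η δT δX c ∧ expKey W c = m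
  · obtain ⟨c, hc, rfl⟩ := hc
    have hsup : lowSpan F W η δT δX (expKey W c + 1) ≤
        Submodule.span F {ev F (mon F c)} ⊔ lowSpan F W η δT δX (expKey W c) := by
      refine Submodule.span_le.2 ?_
      rintro _ ⟨d, hd, hlt, rfl⟩
      rcases Nat.lt_succ_iff_lt_or_eq.1 hlt with h | h
      · exact Submodule.mem_sup_right (mem_lowSpan hd h)
      · rw [hinj d c hd hc h]
        exact Submodule.mem_sup_left (Submodule.mem_span_singleton_self _)
    obtain ⟨_, hy, z, hz, rfl⟩ := Submodule.mem_sup.1 (hsup hn)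
    obtain ⟨k, rfl⟩ := Submodule.mem_span_singleton.1 hy
    have hk : k ≠ 0 := by
      rintro rfl
      exact hm (by simpa using hz)
    refine ⟨W, by omega, c, k⁻¹, hc, ?_, ?_⟩
    · refine (reduction (W := W) (by omega) hη hc).resolve_right fun h => hm ?_
      exact add_mem (Submodule.smul_mem _ _ h) hz
    · rw [smul_add, smul_smul, inv_mul_cancel₀ hk, one_smul, sub_add_cancel_left]
      exact neg_mem (Submodule.smul_mem _ _ hz)
  · exfalso
    apply hm
    refine (Submodule.span_mono ?_ : lowSpan F W η δT δX (m + 1) ≤ _) hn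
    rintro _ ⟨d, hd, hlt, rfl⟩
    refine ⟨d, hd, ?_, rfl⟩
    have : expKey W d ≠ m := fun h => hc ⟨d, hd, h⟩
    omega

variable (F) in
theorem DeltaStar_finite_card {η εT εX : ℕ} (q : ℕ) :
    (DeltaStar F η (εT : ℤ) εX q).Finite ∧
      (DeltaStar F η (εT : ℤ) εX q).ncard ≤ (q + 1) ^ 2 := by
  let f : ℕ × ℕ → MvPolynomial (Fin 4) F := fun p =>
    let α := if p.1 < q then p.1 else εX
    Mmon F η εT εX α (if p.2 < q then p.2 else (εT + η * εX - η * α : ℤ).toNat)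
  have hsub : DeltaStar F η (εT : ℤ) εX q ⊆
      ((Finset.range (q + 1) ×ˢ Finset.range (q + 1)).image f : Finset _) := by
    rintro _ ⟨⟨α, β⟩, hp, rfl⟩
    have hp' : (α, β) ∈ KSet η (εT : ℤ) εX q := by
      unfold KStar at hp
      split_ifs at hp with h
      · exact hp.1
      · exact hp
    obtain ⟨h1, h2⟩ := hp'
    have hα : α < q ∨ α = εX := by
      rcases h1 with h1 | h1
      · left
        have h1' : (α : ℤ) ≤ min _ ((q : ℤ) - 1) := h1
        have := (le_min_iff.1 h1').2
        omega
      · right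
        simpa using h1
    have hβ : β < q ∨ β = (εT + η * εX - η * α : ℤ).toNat := by
      simp only at h2
      omega
    simp only [Finset.coe_image, Set.mem_image]
    refine ⟨(if α < q then α else q, if β < q then β else q), ?_, ?_⟩
    · simp only [Finset.coe_product, Finset.coe_range, Set.mem_prod, Set.mem_Iio]
      constructor <;> split_ifs <;> omega
    · have e1 : (if (if α < q then α else q) < q then (if α < q then α else q) else εX) = α := by
        split_ifs <;> omega
      simp only [f, e1]
      congr 1
      split_ifs <;> omega
  refine ⟨(Finset.finite_toSet _).subset hsub, ?_⟩
  refine (Set.ncard_le_ncard hsub (Finset.finite_toSet _)).trans ?_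
  rw [Set.ncard_coe_finset]
  refine Finset.card_image_le.trans ?_
  simp [sq]

/-- Every function on `F` is a polynomial function of degree less than `q`. -/
theorem exists_pow_sum (f : F → F) :
    ∃ p : ℕ → F, ∀ a, f a = ∑ i ∈ Finset.range (Fintype.card F), p i * a ^ i := by
  let P := Lagrange.interpolate Finset.univ id f
  refine ⟨P.coeff, fun a => ?_⟩
  have hdeg : P.degree < (Fintype.card F : ℕ) :=
    Lagrange.degree_interpolate_lt f (Set.injOn_id _)
  have he : P.eval a = f a :=
    Lagrange.eval_interpolate_at_node f (Set.injOn_id _) (Finset.mem_univ a)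
  rw [← he]
  refine Polynomial.eval_eq_sum_range' ?_ a
  by_cases h : P = 0
  · simp [h, Fintype.card_pos]
  · exact (Polynomial.natDegree_lt_iff_degree_lt h).2 hdeg

theorem Code_eq_top {η εT εX : ℕ} (hT : Fintype.card F ≤ εT) (hX : Fintype.card F ≤ εX) :
    Code F η (εT : ℤ) εX = ⊤ := by
  have hmem : ∀ α β, α ≤ εX → β ≤ εT + η * (εX - α) →
      ev F (mon F ![εT + η * (εX - α) - β, β, εX - α, α]) ∈ Code F η (εT : ℤ) εX := by
    intro α β h1 h2
    refine Submodule.subset_span ⟨_, ⟨_, ⟨?_, ?_⟩, rfl⟩, rfl⟩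
    · simp only [Matrix.cons_val]
      push_cast [h1, h2]
      ring
    · simp only [Matrix.cons_val]
      omega
  have hA : ∀ f g : F → F, (Sum.elim (fun p => f p.1 * g p.2) 0 : HIdx F → F) ∈
      Code F η (εT : ℤ) εX := by
    intro f g
    obtain ⟨p, hp⟩ := exists_pow_sum f
    obtain ⟨r, hr⟩ := exists_pow_sum g
    have : (Sum.elim (fun p => f p.1 * g p.2) 0 : HIdx F → F) =
        ∑ β ∈ Finset.range (Fintype.card F), ∑ α ∈ Finset.range (Fintype.card F),
          (p β * r α) • ev F (mon F ![εT + η * (εX - α) - β, β, εX - α, α]) := by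
      funext i
      simp only [Finset.sum_apply, Pi.smul_apply, smul_eq_mul]
      rcases i with ⟨a, b⟩ | b | a | u
      · simp only [Sum.elim_inl, hp, hr, Finset.sum_mul_sum, ev_mon_inl, Matrix.cons_val]
        refine Finset.sum_congr rfl fun _ _ => Finset.sum_congr rfl fun _ _ => by ring
      all_goals
        symm
        simp only [Sum.elim_inr, Pi.zero_apply]
        refine Finset.sum_eq_zero fun β hβ => Finset.sum_eq_zero fun α hα => ?_
        rw [Finset.mem_range] at hα hβ
        have e0 : εT + η * (εX - α) - β ≠ 0 := by
          have := Nat.zero_le (η * (εX - α)); omega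
        have e2 : εX - α ≠ 0 := by omega
        simp [ev_mon_inr_inl, ev_mon_inr_inr_inl, ev_mon_inr_inr_inr, e0, e2]
    rw [this]
    refine sum_mem fun β hβ => sum_mem fun α hα => Submodule.smul_mem _ _ (hmem _ _ ?_ ?_)
    · rw [Finset.mem_range] at hα; omega
    · rw [Finset.mem_range] at hβ
      have := Nat.zero_le (η * (εX - α)); omega
  have hB : ∀ g : F → F, (Sum.elim 0 (Sum.elim g 0) : HIdx F → F) ∈ Code F η (εT : ℤ) εX := by
    intro g
    obtain ⟨r, hr⟩ := exists_pow_sum g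
    have : (Sum.elim 0 (Sum.elim g 0) : HIdx F → F) =
        ∑ α ∈ Finset.range (Fintype.card F), r α •
          (ev F (mon F ![εT + η * (εX - α) - (εT + η * (εX - α)),
              εT + η * (εX - α), εX - α, α]) -
            Sum.elim (fun p => p.1 ^ (εT + η * (εX - α)) * p.2 ^ α) 0) := by
      funext i
      simp only [Finset.sum_apply, Pi.smul_apply, smul_eq_mul, Pi.sub_apply]
      rcases i with ⟨a, b⟩ | b | a | u
      · simp [ev_mon_inl]
      · simp [ev_mon_inr_inl, hr]
      all_goals
        symm
        refine Finset.sum_eq_zero fun α hα => ?_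
        rw [Finset.mem_range] at hα
        have e2 : εX - α ≠ 0 := by omega
        simp [ev_mon_inr_inr_inl, ev_mon_inr_inr_inr, e2]
    rw [this]
    refine sum_mem fun α hα => Submodule.smul_mem _ _ (sub_mem (hmem _ _ ?_ le_rfl)
      (hA (fun a => a ^ (εT + η * (εX - α))) fun b => b ^ α))
    rw [Finset.mem_range] at hα; omega
  have hC : ∀ f : F → F, (Sum.elim 0 (Sum.elim 0 (Sum.elim f 0)) : HIdx F → F) ∈
      Code F η (εT : ℤ) εX := by
    intro f
    obtain ⟨p, hp⟩ := exists_pow_sum f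
    have : (Sum.elim 0 (Sum.elim 0 (Sum.elim f 0)) : HIdx F → F) =
        ∑ β ∈ Finset.range (Fintype.card F), p β •
          (ev F (mon F ![εT + η * (εX - εX) - β, β, εX - εX, εX]) -
            Sum.elim (fun p => p.1 ^ β * p.2 ^ εX) 0) := by
      funext i
      simp only [Finset.sum_apply, Pi.smul_apply, smul_eq_mul, Pi.sub_apply]
      have e0 : ∀ β ∈ Finset.range (Fintype.card F), εT - β ≠ 0 := by
        intro β hβ
        rw [Finset.mem_range] at hβ; omega
      rcases i with ⟨a, b⟩ | b | a | u
      · simp [ev_mon_inl]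
      · symm
        refine Finset.sum_eq_zero fun β hβ => ?_
        simp [ev_mon_inr_inl, e0 β hβ]
      · simp [ev_mon_inr_inr_inl, hp]
      · symm
        refine Finset.sum_eq_zero fun β hβ => ?_
        simp [ev_mon_inr_inr_inr, e0 β hβ]
    rw [this]
    refine sum_mem fun β hβ => Submodule.smul_mem _ _ (sub_mem (hmem _ _ le_rfl ?_)
      (hA (fun a => a ^ β) fun b => b ^ εX))
    rw [Finset.mem_range] at hβ
    have := Nat.zero_le (η * (εX - εX)); omega
  have hD : (Sum.elim 0 (Sum.elim 0 (Sum.elim 0 1)) : HIdx F → F) ∈ Code F η (εT : ℤ) εX := by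
    have : (Sum.elim 0 (Sum.elim 0 (Sum.elim 0 1)) : HIdx F → F) =
        ev F (mon F ![εT + η * (εX - εX) - εT, εT, εX - εX, εX]) -
          (Sum.elim (fun p => p.1 ^ εT * p.2 ^ εX) 0 : HIdx F → F) -
          (Sum.elim 0 (Sum.elim (fun b => b ^ εX) 0) : HIdx F → F) -
          (Sum.elim 0 (Sum.elim 0 (Sum.elim (fun a => a ^ εT) 0)) : HIdx F → F) := by
      funext i
      rcases i with ⟨a, b⟩ | b | a | u
      · simp [ev_mon_inl]
      · simp [ev_mon_inr_inl]
      · simp [ev_mon_inr_inr_inl]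
      · simp [ev_mon_inr_inr_inr]
    rw [this]
    exact sub_mem (sub_mem (sub_mem (hmem _ _ le_rfl (by simp))
      (hA (fun a => a ^ εT) fun b => b ^ εX)) (hB _)) (hC _)
  refine eq_top_iff.2 fun x _ => ?_
  have : x = (∑ s, (Sum.elim (fun p => (if p.1 = s then 1 else 0) * x (Sum.inl (s, p.2))) 0 :
        HIdx F → F)) +
      (Sum.elim 0 (Sum.elim (fun b => x (Sum.inr (Sum.inl b))) 0) : HIdx F → F) +
      (Sum.elim 0 (Sum.elim 0 (Sum.elim (fun a => x (Sum.inr (Sum.inr (Sum.inl a)))) 0)) :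
        HIdx F → F) +
      x (Sum.inr (Sum.inr (Sum.inr ()))) •
        (Sum.elim 0 (Sum.elim 0 (Sum.elim 0 1)) : HIdx F → F) := by
    funext i
    rcases i with ⟨a, b⟩ | b | a | u <;> simp
  rw [this]
  exact add_mem (add_mem (add_mem (sum_mem fun s _ => hA (fun a => if a = s then 1 else 0)
    fun b => x (Sum.inl (s, b))) (hB _)) (hC _)) (Submodule.smul_mem _ _ hD)

/-- The footprint bound: a lower bound on the weight of a nonzero codeword. -/
theorem footprint_bound {η : ℕ} {δT : ℤ} {δX : ℕ} (hη : δT < 0 → 0 < η) {εT εX : ℕ}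
    (hT : Fintype.card F ≤ εT) (hX : Fintype.card F ≤ εX) {v : HIdx F → F}
    (hv : v ∈ Code F η δT δX) (hv0 : v ≠ 0) :
    ∃ M ∈ DeltaStar F η δT δX (Fintype.card F),
      {N ∈ DeltaStar F η (εT : ℤ) εX (Fintype.card F) | M ∣ N}.ncard ≤ wt F v := by
  obtain ⟨W, hW, c, k, hc, hM, hlow⟩ := exists_leading hη hv hv0
  refine ⟨mon F c, hM, ?_⟩
  obtain ⟨hfin, hcard⟩ := DeltaStar_finite_card F (η := η) (εT := εT) (εX := εX) (Fintype.card F)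
  set D := DeltaStar F η (εT : ℤ) εX (Fintype.card F) with hD
  let r : (HIdx F → F) →ₗ[F] ({i // v i = 0} → F) := LinearMap.funLeft F F Subtype.val
  have hrv : r v = 0 := by
    funext i
    exact i.2
  have hrmul : ∀ u, r (u * v) = 0 := by
    intro u
    funext i
    simp [r, LinearMap.funLeft, i.2]
  let T : Set (MvPolynomial (Fin 4) F) := {N ∈ D | ¬ mon F c ∣ N}
  have hTfin : T.Finite := hfin.subset fun _ h => h.1
  let S := Submodule.span F ((fun N => r (ev F N)) '' T)
  have hS : ∀ n d, expKey W d = n → IsBideg η (εT : ℤ) εX d → r (ev F (mon F d)) ∈ S := by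
    intro n
    induction n using Nat.strong_induction_on with
    | _ n ih =>
      rintro d rfl hd
      have hlowS : ∀ u ∈ lowSpan F W η (εT : ℤ) εX (expKey W d), r u ∈ S := by
        intro u hu
        refine (Submodule.span_le.2 ?_ : lowSpan F W η (εT : ℤ) εX _ ≤ S.comap r) hu
        rintro _ ⟨d', hd', hlt, rfl⟩
        exact ih _ hlt d' rfl hd'
      by_cases hdvd : mon F c ∣ mon F d
      · obtain ⟨e, rfl⟩ : ∃ e, d = c + e :=
          ⟨d - c, (add_tsub_cancel_of_le (le_of_mon_dvd_mon F hdvd)).symm⟩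
        have h := hlowS _ (by
          rw [expKey_add]
          exact ev_mon_mul_mem_lowSpan hc hd hlow)
        rw [mul_sub, mul_comm, ← ev_mon_add, mul_smul_comm, map_sub, map_smul, hrmul,
          smul_zero, sub_zero] at h
        exact h
      · rcases reduction (F := F) hW (fun h => absurd h (by omega)) hd with h | h
        · exact Submodule.subset_span ⟨_, ⟨h, hdvd⟩, rfl⟩
        · exact hlowS _ h
  have hStop : S = ⊤ := by
    have h1 : Code F η (εT : ℤ) εX ≤ S.comap r := by
      refine Submodule.span_le.2 ?_
      rintro _ ⟨_, ⟨d, hd, rfl⟩, rfl⟩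
      exact hS _ d rfl hd
    rw [Code_eq_top hT hX] at h1
    refine eq_top_iff.2 fun x _ => ?_
    obtain ⟨y, rfl⟩ := LinearMap.funLeft_surjective_of_injective F F
      (Subtype.val : {i // v i = 0} → HIdx F) Subtype.val_injective x
    exact h1 (Submodule.mem_top : y ∈ ⊤)
  have hZ : Fintype.card {i // v i = 0} ≤ T.ncard := by
    have hfi := hTfin.image (fun N => r (ev F N))
    have := hfi.fintype
    have h2 := finrank_span_le_card (R := F) ((fun N => r (ev F N)) '' T)
    change Module.finrank F S ≤ _ at h2
    rw [hStop, finrank_top, Module.finrank_fintype_fun_eq_card, ← Set.ncard_eq_toFinset_card'] at h2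
    exact h2.trans (Set.ncard_image_le hTfin)
  have hsplit : {N ∈ D | mon F c ∣ N}.ncard + T.ncard = D.ncard := by
    rw [← Set.ncard_union_eq _ (hfin.subset fun _ h => h.1) hTfin]
    · congr 1
      ext N
      simp only [T, Set.mem_union, Set.mem_ofPred_eq]
      tauto
    · rw [Set.disjoint_left]
      exact fun N h1 h2 => h2.2 h1.2
  have hwt : wt F v + Fintype.card {i // v i = 0} = (Fintype.card F + 1) ^ 2 := by
    have h1 : wt F v = Fintype.card {i // ¬ v i = 0} := by
      rw [← Nat.card_eq_fintype_card]; rfl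
    rw [h1, Fintype.card_subtype_compl, Nat.sub_add_cancel (Fintype.card_subtype_le _)]
    simp only [HIdx, Fintype.card_sum, Fintype.card_prod, Fintype.card_unit]
    ring
  omega

variable (F)

/-- for `εT, εX ≥ q`, the minimum distance of `C_η(δT,δX)` is at least
the minimum over `M ∈ Δ*(δT,δX)` of the number of monomials of `Δ*(εT,εX)`
divisible by `M`. -/
theorem statement10 (η : ℕ) (δT : ℤ) (δX : ℕ)
    (hδ : 0 ≤ δT + (η : ℤ) * (δX : ℤ)) (hη : δT < 0 → 0 < η)
    (εT εX : ℕ) (hT : Fintype.card F ≤ εT) (hX : Fintype.card F ≤ εX) :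
    sInf {n : ℕ | ∃ M ∈ DeltaStar F η δT δX (Fintype.card F),
        n = {N ∈ DeltaStar F η (εT : ℤ) εX (Fintype.card F) | M ∣ N}.ncard}
      ≤ dmin F η δT δX := by
  have hne : {w : ℕ | ∃ v ∈ Code F η δT δX, v ≠ 0 ∧ wt F v = w}.Nonempty := by
    have hmem : ev F (mon F ![(δT + (η : ℤ) * δX).toNat, 0, δX, 0]) ∈ Code F η δT δX := by
      refine Submodule.subset_span ⟨_, ⟨_, ⟨?_, ?_⟩, rfl⟩, rfl⟩
      · simp [hδ]
      · simp
    refine ⟨_, _, hmem, fun h => ?_, rfl⟩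
    have := congrFun h (Sum.inl (0, 0))
    simp [ev_mon_inl] at this
  obtain ⟨v, hv, hv0, hw⟩ := Nat.sInf_mem hne
  obtain ⟨M, hM, hle⟩ := footprint_bound hη hT hX hv hv0
  rw [dmin, ← hw]
  refine le_trans (Nat.sInf_le ?_) hle
  exact ⟨M, hM, rfl⟩

end Hirz
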